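/- Let a be a real number with 0 < a < 1 and let s be a complex number that is not a nonnegative integer. Then the series below converges and ζ(1−s, a) − ζ(1−s, 1−a) = a^{s−1} − 2 Σ_{k=0}^∞ C(2k+1−s, 2k+1) ζ(2−s+2k) a^{2k+1}. -/

import Mathlib

open Real Complex HurwitzZeta

/-- Generalized binomial coefficient `C(w, k) = w(w-1)⋯(w-k+1)/k!`. -/
noncomputable def genBinom (w : ℂ) (k : ℕ) : ℂ :=
  (∏ j ∈ Finset.range k, (w - j)) / (k.factorial : ℂ)

/-- Rising factorial divided by factorial. -/
noncomputable def rfac (w : ℂ) (n : ℕ) : ℂ :=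
  (∏ j ∈ Finset.range n, (w + j)) / (n.factorial : ℂ)

theorem genBinom_eq_rfac (w : ℂ) (n : ℕ) : genBinom (w + n) (n + 1) = rfac w (n + 1) := by
  unfold genBinom rfac
  congr 1
  rw [← Finset.prod_range_reflect]
  refine Finset.prod_congr rfl fun j hj => ?_
  have hj' : j ≤ n := by simpa [Nat.lt_succ_iff] using hj
  have : n + 1 - 1 - j = n - j := by omega
  rw [this, Nat.cast_sub hj']
  ring

theorem rfac_eq_choose (w : ℂ) (n : ℕ) : Ring.choose (w + n - 1) n = rfac w n := by
  rw [Ring.choose_eq_smul, Polynomial.descPochhammer_smeval_eq_ascPochhammer,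
    Polynomial.ascPochhammer_smeval_cast, Polynomial.ascPochhammer_smeval_eq_eval,
    show w + n - 1 - n + 1 = w by ring]
  have : ∀ m : ℕ, (ascPochhammer ℂ m).eval w = ∏ j ∈ Finset.range m, (w + j) := by
    intro m
    induction m with
    | zero => simp
    | succ m ih => rw [ascPochhammer_succ_eval, ih, Finset.prod_range_succ]
  rw [this, rfac, smul_eq_mul, div_eq_inv_mul]

theorem hasSum_rfac (w x : ℂ) (hx : ‖x‖ < 1) :
    HasSum (fun n : ℕ => rfac w n * x ^ n) ((1 - x) ^ (-w)) := by
  have h := (Complex.one_div_one_sub_cpow_hasFPowerSeriesOnBall_zero w).hasSum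
    (y := x) (by simpa [enorm_eq_nnnorm] using! hx)
  simp only [rfac_eq_choose] at h
  rw [zero_add, one_div, ← Complex.cpow_neg] at h
  refine h.congr_fun ?_ 
  intro n
  simp [FormalMultilinearSeries.ofScalars, mul_comm]

theorem hasSum_rfac_odd (w x : ℂ) (hx : ‖x‖ < 1) :
    HasSum (fun k : ℕ => 2 * (rfac w (2 * k + 1) * x ^ (2 * k + 1)))
      ((1 - x) ^ (-w) - (1 + x) ^ (-w)) := by
  have h1 := hasSum_rfac w x hx
  have h2 := hasSum_rfac w (-x) (by simpa using hx)
  rw [sub_neg_eq_add] at h2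
  have h := h1.sub h2
  have hinj : Function.Injective (fun k : ℕ => 2 * k + 1) := fun a b h => by
    simp only at h; omega
  rw [← hinj.hasSum_iff] at h
  · refine h.congr_fun ?_
    intro k
    simp only [Function.comp, Odd.neg_pow (odd_two_mul_add_one k)]
    ring
  · intro n hn
    have : Even n := by
      by_contra h
      rw [Nat.not_even_iff_odd] at h
      obtain ⟨k, rfl⟩ := h
      exact hn ⟨k, rfl⟩
    rw [this.neg_pow]; ring

theorem norm_rfac_le (w : ℂ) (R : ℝ) (hR : ‖w‖ ≤ R) (n : ℕ) : ‖rfac w n‖ ≤ ‖rfac (R : ℂ) n‖ := by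
  have hR0 : 0 ≤ R := (norm_nonneg w).trans hR
  unfold rfac
  rw [norm_div, norm_div, norm_prod, norm_prod]
  gcongr with j hj
  have : ((R : ℂ) + j) = ((R + j : ℝ) : ℂ) := by push_cast; rfl
  rw [this, Complex.norm_real, Real.norm_of_nonneg (by positivity)]
  exact (norm_add_le _ _).trans (by simpa using hR)

theorem summable_bound (R a : ℝ) (ha : 0 < a) (ha' : a < 1) :
    Summable (fun k : ℕ => ‖rfac (R : ℂ) (2 * k + 1)‖ * a ^ (2 * k + 1)) := by
  have h := (hasSum_rfac_odd (R : ℂ) (a : ℂ) (by simpa [abs_of_pos ha] using ha')).summable.norm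
  have := h.mul_left (1 / 2)
  refine this.congr ?_
  intro k
  simp [abs_of_pos ha]

theorem norm_term_le {a : ℝ} (n : ℕ) (z : ℂ) (hz : 2 ≤ z.re) :
    ‖1 / ((n : ℂ) + 1) ^ z‖ ≤ 1 / ((n : ℝ) + 1) ^ 2 := by
  have : ((n : ℂ) + 1) = ((n + 1 : ℝ) : ℂ) := by push_cast; rfl
  rw [norm_div, norm_one, this, Complex.norm_cpow_eq_rpow_re_of_pos (by positivity)]
  gcongr
  rw [← Real.rpow_natCast]
  exact Real.rpow_le_rpow_of_exponent_le (by linarith [(Nat.cast_nonneg n : (0 : ℝ) ≤ n)])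
    (by simpa using hz)

theorem summable_inv_sq : Summable (fun n : ℕ => 1 / ((n : ℝ) + 1) ^ 2) := by
  have := (summable_nat_add_iff 1).2 (Real.summable_one_div_nat_pow.2 (one_lt_two))
  simpa using this

theorem norm_zeta_le (z : ℂ) (hz : 2 ≤ z.re) :
    ‖riemannZeta z‖ ≤ ∑' n : ℕ, 1 / ((n : ℝ) + 1) ^ 2 := by
  rw [zeta_eq_tsum_one_div_nat_add_one_cpow (by linarith)]
  exact tsum_of_norm_bounded summable_inv_sq.hasSum fun n => norm_term_le (a := 0) n z hz

/-- The general term, in the variable `w = 1 - s`. -/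
noncomputable def hterm (a : ℝ) (k : ℕ) (w : ℂ) : ℂ :=
  rfac w (2 * k + 1) * riemannZeta (w + 1 + 2 * k) * (a : ℂ) ^ (2 * k + 1)

theorem norm_hterm_le (a : ℝ) (ha : 0 < a) (k : ℕ) (w : ℂ) (R : ℝ) (hR : ‖w‖ ≤ R)
    (hk : R + 1 ≤ 2 * k) :
    ‖hterm a k w‖ ≤ (∑' n : ℕ, 1 / ((n : ℝ) + 1) ^ 2) *
      (‖rfac (R : ℂ) (2 * k + 1)‖ * a ^ (2 * k + 1)) := by
  have h1 := norm_rfac_le w R hR (2 * k + 1)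
  have hre : 2 ≤ (w + 1 + 2 * k).re := by
    have := neg_le_of_abs_le (Complex.abs_re_le_norm w)
    simp
    linarith
  have h2 := norm_zeta_le _ hre
  unfold hterm
  rw [norm_mul, norm_mul, norm_pow, Complex.norm_real, Real.norm_of_nonneg ha.le]
  calc _ ≤ ‖rfac (R : ℂ) (2 * k + 1)‖ * (∑' n : ℕ, 1 / ((n : ℝ) + 1) ^ 2) * a ^ (2 * k + 1) := by
        gcongr
    _ = _ := by ring

theorem differentiableAt_hterm (a : ℝ) (k : ℕ) (w : ℂ) (hw : w + 2 * k ≠ 0) :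
    DifferentiableAt ℂ (hterm a k) w := by
  unfold hterm rfac
  have : DifferentiableAt ℂ (fun w : ℂ => riemannZeta (w + 1 + 2 * k)) w := by
    refine DifferentiableAt.comp (g := riemannZeta) w (differentiableAt_riemannZeta ?_) (by fun_prop)
    intro h
    apply hw
    linear_combination h
  refine DifferentiableAt.mul_const (DifferentiableAt.mul ?_ this) _
  refine DifferentiableAt.div_const ?_ _
  exact DifferentiableAt.fun_finsetProd fun i _ => by fun_prop

theorem exists_N (R : ℝ) : ∃ N : ℕ, ∀ k : ℕ, N ≤ k → R + 1 ≤ 2 * k := by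
  obtain ⟨N, hN⟩ := exists_nat_ge (R + 1)
  refine ⟨N, fun k hk => ?_⟩
  have : (N : ℝ) ≤ k := by exact_mod_cast hk
  linarith [(Nat.cast_nonneg k : (0 : ℝ) ≤ k)]

theorem summable_hterm (a : ℝ) (ha : 0 < a) (ha' : a < 1) (w : ℂ) :
    Summable (fun k => hterm a k w) := by
  obtain ⟨N, hN⟩ := exists_N ‖w‖
  rw [← summable_nat_add_iff N]
  have hb := (summable_nat_add_iff N).2
    ((summable_bound ‖w‖ a ha ha').mul_left (∑' n : ℕ, 1 / ((n : ℝ) + 1) ^ 2))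
  exact Summable.of_norm_bounded hb fun k =>
    norm_hterm_le a ha (k + N) w ‖w‖ le_rfl (hN _ (by omega))

theorem differentiableAt_tsum_hterm (a : ℝ) (ha : 0 < a) (ha' : a < 1) (w : ℂ)
    (hw : ∀ n : ℕ, w + n ≠ 0) :
    DifferentiableAt ℂ (fun w => ∑' k, hterm a k w) w := by
  obtain ⟨N, hN⟩ := exists_N (‖w‖ + 1)
  have heq : (fun w => ∑' k, hterm a k w) =
      fun w => ∑ k ∈ Finset.range N, hterm a k w + ∑' k, hterm a (k + N) w := by
    funext w
    exact ((summable_hterm a ha ha' w).sum_add_tsum_nat_add N).symm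
  have hball : ∀ z ∈ Metric.ball w 1, ‖z‖ ≤ ‖w‖ + 1 := by
    intro z hz
    have h1 : ‖z - w‖ < 1 := by simpa [dist_eq_norm] using hz
    have h2 := norm_add_le (z - w) w
    rw [sub_add_cancel] at h2
    linarith
  rw [heq]
  refine DifferentiableAt.add ?_ ?_
  · refine DifferentiableAt.fun_sum fun k _ => differentiableAt_hterm a k w ?_
    have := hw (2 * k)
    simpa using this
  · have hb := (summable_nat_add_iff N).2
      ((summable_bound (‖w‖ + 1) a ha ha').mul_left (∑' n : ℕ, 1 / ((n : ℝ) + 1) ^ 2))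
    refine (Complex.differentiableOn_tsum_of_summable_norm (U := Metric.ball w 1) hb ?_
      Metric.isOpen_ball ?_).differentiableAt (Metric.isOpen_ball.mem_nhds (by simp))
    · intro k z hz
      refine (differentiableAt_hterm a (k + N) z ?_).differentiableWithinAt
      intro h
      have h1 := hball z hz
      have h2 := hN (k + N) (by omega)
      have h3 : ‖z‖ = 2 * ((k + N : ℕ) : ℝ) := by
        rw [eq_neg_of_add_eq_zero_left h]
        simp
        norm_cast
      linarith
    · intro k z hz
      exact norm_hterm_le a ha (k + N) z _ (hball z hz) (hN _ (by omega))

theorem cpow_scale (x : ℝ) (n : ℕ) (hx : -1 < x) (hx' : x < 1) (w : ℂ) :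
    1 / ((n : ℂ) + 1 + x) ^ w = 1 / ((n : ℂ) + 1) ^ w * (1 + (x : ℂ) / ((n : ℂ) + 1)) ^ (-w) := by
  have hn : (0 : ℝ) < n + 1 := by positivity
  have hn' : (0 : ℝ) ≤ n := by positivity
  have hp : 0 ≤ 1 + x / (n + 1) := by
    have : (1 + x / ((n : ℝ) + 1)) = (n + 1 + x) / (n + 1) := by field_simp
    rw [this]
    apply div_nonneg <;> linarith
  have e1 : ((n : ℂ) + 1 + x) = ((n + 1 : ℝ) : ℂ) * ((1 + x / (n + 1) : ℝ) : ℂ) := by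
    have : ((n : ℂ) + 1) ≠ 0 := by exact_mod_cast hn.ne'
    push_cast
    field_simp
  rw [e1, Complex.mul_cpow_ofReal_nonneg hn.le hp, Complex.cpow_neg]
  push_cast
  rw [one_div, mul_inv, one_div]

theorem main_re_gt (a : ℝ) (ha : 0 < a) (ha' : a < 1) (w : ℂ) (hw : 1 < w.re) :
    hurwitzZeta (a : UnitAddCircle) w - hurwitzZeta ((1 - a : ℝ) : UnitAddCircle) w
      = (a : ℂ) ^ (-w) - 2 * ∑' k : ℕ, hterm a k w := by
  have h1 := hasSum_hurwitzZeta_of_one_lt_re (a := a) ⟨ha.le, ha'.le⟩ hw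
  have h2 := hasSum_hurwitzZeta_of_one_lt_re (a := 1 - a) ⟨by linarith, by linarith⟩ hw
  rw [← hasSum_nat_add_iff' 1] at h1
  have h3 := h1.sub h2
  -- the double series
  let F : ℕ → ℕ → ℂ := fun n k =>
    2 * (rfac w (2 * k + 1) * (1 / ((n : ℂ) + 1) ^ (w + 1 + 2 * k)) * (a : ℂ) ^ (2 * k + 1))
  have hpos : ∀ n : ℕ, (0 : ℝ) < n + 1 := fun n => by positivity
  have hne : ∀ n : ℕ, ((n : ℂ) + 1) ≠ 0 := fun n => by exact_mod_cast (hpos n).ne'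
  have hrow : ∀ n : ℕ, HasSum (fun k => F n k)
      (-(1 / (((n + 1 : ℕ) : ℂ) + a) ^ w - 1 / ((n : ℂ) + ((1 - a : ℝ) : ℂ)) ^ w)) := by
    intro n
    have hx : ‖(a : ℂ) / ((n : ℂ) + 1)‖ < 1 := by
      have : (a : ℂ) / ((n : ℂ) + 1) = ((a / (n + 1) : ℝ) : ℂ) := by push_cast; rfl
      rw [this, Complex.norm_real, Real.norm_of_nonneg (by positivity), div_lt_one (hpos n)]
      linarith [(Nat.cast_nonneg n : (0 : ℝ) ≤ n)]
    have h := (hasSum_rfac_odd w _ hx).mul_left (1 / ((n : ℂ) + 1) ^ w)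
    have e1 := cpow_scale a n (by linarith) ha' w
    have e2 := cpow_scale (-a) n (by linarith) (by linarith) w
    convert! h using 1
    · funext k
      simp only [F]
      have : ((n : ℂ) + 1) ^ (w + 1 + 2 * k) = ((n : ℂ) + 1) ^ w * ((n : ℂ) + 1) ^ (2 * k + 1) := by
        rw [← Complex.cpow_natCast, ← Complex.cpow_add _ _ (hne n)]
        congr 1
        push_cast
        ring
      rw [this, div_pow, one_div, mul_inv]
      ring
    · have e3 : (((n + 1 : ℕ) : ℂ) + a) = (n : ℂ) + 1 + a := by push_cast; ring
      have e4 : ((n : ℂ) + ((1 - a : ℝ) : ℂ)) = (n : ℂ) + 1 + ((-a : ℝ) : ℂ) := by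
        push_cast; ring
      rw [e3, e4, e1, e2]
      push_cast
      rw [neg_div, ← sub_eq_add_neg]
      ring
  have hcol : ∀ k : ℕ, HasSum (fun n => F n k) (2 * hterm a k w) := by
    intro k
    have hre : 2 ≤ (w + 1 + 2 * k).re := by
      simp
      linarith [(Nat.cast_nonneg k : (0 : ℝ) ≤ k)]
    have hs : Summable (fun n : ℕ => 1 / ((n : ℂ) + 1) ^ (w + 1 + 2 * k)) :=
      Summable.of_norm_bounded summable_inv_sq fun n => norm_term_le (a := 0) n _ hre
    have h := hs.hasSum
    rw [← zeta_eq_tsum_one_div_nat_add_one_cpow (by linarith)] at h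
    exact ((h.mul_left (rfac w (2 * k + 1))).mul_right ((a : ℂ) ^ (2 * k + 1))).mul_left 2
  have hsum : Summable (fun p : ℕ × ℕ => F p.1 p.2) := by
    have hb := (summable_inv_sq.mul_of_nonneg (summable_bound ‖w‖ a ha ha')
      (fun n => by positivity) (fun k => by positivity)).mul_left 2
    refine Summable.of_norm_bounded hb fun p => ?_
    have hre : 2 ≤ (w + 1 + 2 * p.2).re := by
      simp
      linarith [(Nat.cast_nonneg p.2 : (0 : ℝ) ≤ p.2)]
    have b1 := norm_rfac_le w ‖w‖ le_rfl (2 * p.2 + 1)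
    have b2 := norm_term_le (a := 0) p.1 _ hre
    simp only [F]
    rw [norm_mul, norm_mul, norm_mul, norm_pow, Complex.norm_real, Real.norm_of_nonneg ha.le,
      Complex.norm_ofNat]
    calc _ ≤ 2 * (‖rfac (‖w‖ : ℂ) (2 * p.2 + 1)‖ * (1 / ((p.1 : ℝ) + 1) ^ 2)
          * a ^ (2 * p.2 + 1)) := by gcongr
      _ = _ := by ring
  have hcomm := Summable.tsum_comm (f := F) hsum
  have e1 : ∑' n, ∑' k, F n k = -(hurwitzZeta (a : UnitAddCircle) w
      - ∑ i ∈ Finset.range 1, 1 / ((i : ℂ) + a) ^ w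
      - hurwitzZeta ((1 - a : ℝ) : UnitAddCircle) w) := by
    rw [← h3.neg.tsum_eq]
    exact tsum_congr fun n => (hrow n).tsum_eq
  have e2 : ∑' k, ∑' n, F n k = 2 * ∑' k, hterm a k w := by
    rw [← tsum_mul_left]
    exact tsum_congr fun k => (hcol k).tsum_eq
  rw [← e2, hcomm, e1, Complex.cpow_neg]
  simp
  ring

theorem main_w (a : ℝ) (ha : 0 < a) (ha' : a < 1) (w : ℂ) (hw : ∀ n : ℕ, w + n ≠ 0) :
    hurwitzZeta (a : UnitAddCircle) w - hurwitzZeta ((1 - a : ℝ) : UnitAddCircle) w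
      = (a : ℂ) ^ (-w) - 2 * ∑' k : ℕ, hterm a k w := by
  let U : Set ℂ := (Set.range fun n : ℕ => -(n : ℂ))ᶜ
  have hmem : ∀ z : ℂ, z ∈ U ↔ ∀ n : ℕ, z + n ≠ 0 := by
    intro z
    simp only [U, Set.mem_compl_iff, Set.mem_range, not_exists]
    refine forall_congr' fun n => not_congr ?_
    rw [eq_comm, eq_neg_iff_add_eq_zero]
  have hclosed : IsClosed (Set.range fun n : ℕ => -(n : ℂ)) := by
    have h := Nat.isClosedEmbedding_coe_real
    have h' := (Complex.isometry_ofReal.isClosedEmbedding.comp h)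
    have h2 := (Homeomorph.neg ℂ).isClosedEmbedding.comp h'
    convert h2.isClosed_range using 2
    funext n
    simp
  have hopen : IsOpen U := hclosed.isOpen_compl
  have hconn : IsPreconnected U :=
    ((Set.countable_range _).isConnected_compl_of_one_lt_rank (by simp)).isPreconnected
  have hane : (a : ℂ) ≠ 0 := by exact_mod_cast ha.ne'
  have hL : AnalyticOnNhd ℂ (fun w => hurwitzZeta (a : UnitAddCircle) w
      - hurwitzZeta ((1 - a : ℝ) : UnitAddCircle) w) U :=
    (differentiable_hurwitzZeta_sub_hurwitzZeta _ _).differentiableOn.analyticOnNhd hopen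
  have hR : AnalyticOnNhd ℂ (fun w => (a : ℂ) ^ (-w) - 2 * ∑' k : ℕ, hterm a k w) U := by
    refine DifferentiableOn.analyticOnNhd (fun z hz => ?_) hopen
    refine DifferentiableAt.differentiableWithinAt ?_
    refine DifferentiableAt.sub ?_ ?_
    · exact DifferentiableAt.const_cpow (by fun_prop) (Or.inl hane)
    · exact (differentiableAt_tsum_hterm a ha ha' z ((hmem z).1 hz)).const_mul 2
  have h2 : (2 : ℂ) ∈ U := by
    rw [hmem]
    intro n
    norm_cast
    omega
  refine hL.eqOn_of_preconnected_of_eventuallyEq hR hconn h2 ?_ ((hmem w).2 hw)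
  have : {z : ℂ | 1 < z.re} ∈ nhds (2 : ℂ) :=
    (isOpen_lt continuous_const Complex.continuous_re).mem_nhds (by simp)
  filter_upwards [this] with z hz
  exact main_re_gt a ha ha' z hz

theorem hurwitz_odd_expansion (a : ℝ) (ha : 0 < a) (ha' : a < 1) (s : ℂ)
    (hs : ∀ n : ℕ, s ≠ n) :
    Summable (fun k : ℕ =>
      genBinom (2 * (k : ℂ) + 1 - s) (2 * k + 1) * riemannZeta (2 - s + 2 * k)
        * (a : ℂ) ^ (2 * k + 1)) ∧
    hurwitzZeta (a : UnitAddCircle) (1 - s) - hurwitzZeta ((1 - a : ℝ) : UnitAddCircle) (1 - s)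
      = (a : ℂ) ^ (s - 1)
        - 2 * ∑' k : ℕ,
            genBinom (2 * (k : ℂ) + 1 - s) (2 * k + 1) * riemannZeta (2 - s + 2 * k)
              * (a : ℂ) ^ (2 * k + 1) := by
  have hterm_eq : (fun k : ℕ =>
      genBinom (2 * (k : ℂ) + 1 - s) (2 * k + 1) * riemannZeta (2 - s + 2 * k)
        * (a : ℂ) ^ (2 * k + 1)) = fun k => hterm a k (1 - s) := by
    funext k
    unfold hterm
    rw [← genBinom_eq_rfac]
    congr 3
    · push_cast; ring
    · ring
  rw [hterm_eq]
  refine ⟨summable_hterm a ha ha' (1 - s), ?_⟩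
  rw [main_w a ha ha' (1 - s), neg_sub]
  intro n h
  apply hs (n + 1)
  push_cast
  linear_combination -h
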